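/- arXiv:2405.03895 — 2 statements merged into one kernel-verified Lean document; each statement's English description precedes it below -/
import Mathlib

section
/- Let V be an n-dimensional complex inner product space and R a Kähler-type curvature tensor on V (i.e., R is ℝ-multilinear in (X, X̄, Y, Ȳ), conjugate symmetric, and satisfies the Kähler symmetries R(X,Ȳ,Z,W̄)=R(Z,Ȳ,X,W̄)=R(X,W̄,Z,Ȳ)). Then the scalar curvature S = Σ_{i,j} R(e_i, ē_i, e_j, ē_j) (for any unitary basis {e_i}) satisfies Berger's identity: S = (n(n+1))/(2·Vol(S^{2n-1})) · ∫_{|Z|=1} H(Z) dθ(Z), where H(Z) = R(Z,Z̄,Z,Z̄) for unit vectors Z and the integral is with respect to the standard measure on the unit sphere of V. -/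
open MeasureTheory

/-- A curvature tensor of Kähler type on a complex vector space: complex linear in the 1st
(hence 3rd) slot, conjugate linear in the 2nd (hence 4th), conjugate symmetric, and symmetric
under the exchanges `X ↔ Z` and `Y ↔ W` (so in particular it is `ℝ`-multilinear). -/
structure IsKahlerCurvature {V : Type*} [AddCommGroup V] [Module ℂ V]
    (R : V → V → V → V → ℂ) : Prop where
  linear_fst : ∀ Y Z W, IsLinearMap ℂ fun X => R X Y Z W
  conjLinear_snd : ∀ X Z W (c : ℂ) (Y₁ Y₂ : V),
    R X (c • Y₁ + Y₂) Z W = starRingEnd ℂ c * R X Y₁ Z W + R X Y₂ Z W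
  conj_symm : ∀ X Y Z W, R X Y Z W = starRingEnd ℂ (R Y X W Z)
  symm_fst_trd : ∀ X Y Z W, R X Y Z W = R Z Y X W
  symm_snd_fourth : ∀ X Y Z W, R X Y Z W = R X W Z Y

theorem sphere_lt_top {E : Type*} [NormedAddCommGroup E] [InnerProductSpace ℝ E]
    [FiniteDimensional ℝ E] [MeasurableSpace E] [BorelSpace E] (d : ℕ)
    (hd : Module.finrank ℝ E = d + 1) :
    μH[(d : ℝ)] (Metric.sphere (0 : E) 1) < ⊤ := by
  have : Fact (Module.finrank ℝ E = d + 1) := ⟨hd⟩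
  refine (isCompact_sphere (0 : E) 1).measure_lt_top_of_nhdsWithin fun v hv => ?_
  have hv1 : ‖v‖ = 1 := by simpa using hv
  have hv0 : v ≠ 0 := by rintro rfl; simp at hv1
  let W := (Submodule.span ℝ {v})ᗮ
  have hW : Module.finrank ℝ W = d := Submodule.finrank_orthogonal_span_singleton hv0
  have horth : ∀ w : W, inner ℝ v (w : E) = 0 := fun w =>
    Submodule.mem_orthogonal_singleton_iff_inner_right.1 w.2
  let φ : W → E := fun w => (‖v + (w : E)‖)⁻¹ • (v + (w : E))
  have hge : ∀ w : W, 1 ≤ ‖v + (w : E)‖ := by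
    intro w
    have h : inner ℝ v (v + (w : E)) = 1 := by
      rw [inner_add_right, horth, real_inner_self_eq_norm_sq, hv1]; norm_num
    have := real_inner_le_norm v (v + (w : E))
    rw [h, hv1, one_mul] at this
    exact this
  have hφ : LipschitzWith 2 φ := by
    refine LipschitzWith.of_dist_le_mul fun x y => ?_
    have hx := hge x
    have hy := hge y
    set a := v + (x : E)
    set b := v + (y : E)
    have hab : dist x y = ‖a - b‖ := by
      rw [Subtype.dist_eq, dist_eq_norm]; congr 1; simp [a, b]
    rw [hab, dist_eq_norm]
    change ‖(‖a‖)⁻¹ • a - (‖b‖)⁻¹ • b‖ ≤ _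
    have e1 : (‖a‖)⁻¹ • a - (‖b‖)⁻¹ • b = (‖a‖)⁻¹ • ((a - b) + (‖b‖ - ‖a‖) • ((‖b‖)⁻¹ • b)) := by
      have ha0 : ‖a‖ ≠ 0 := by linarith
      have hb0 : ‖b‖ ≠ 0 := by linarith
      clear_value a b
      match_scalars <;> field_simp <;> ring
    rw [e1, norm_smul, norm_inv, norm_norm]
    have hb1 : ‖(‖b‖)⁻¹ • b‖ = 1 := by
      rw [norm_smul, norm_inv, norm_norm, inv_mul_cancel₀ (by linarith)]
    have h2 : ‖(a - b) + (‖b‖ - ‖a‖) • ((‖b‖)⁻¹ • b)‖ ≤ 2 * ‖a - b‖ := by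
      refine (norm_add_le _ _).trans ?_
      rw [norm_smul, hb1, mul_one, Real.norm_eq_abs, abs_sub_comm]
      have := abs_norm_sub_norm_le a b
      linarith
    have h3 : (‖a‖)⁻¹ ≤ 1 := inv_le_one_of_one_le₀ hx
    calc _ ≤ 1 * (2 * ‖a - b‖) := by gcongr
      _ = _ := by simp
  have hU : {y : E | (1/2 : ℝ) < inner ℝ v y} ∈ nhds v := by
    refine IsOpen.mem_nhds (isOpen_lt continuous_const (by fun_prop)) ?_
    simp [hv1]; norm_num
  refine ⟨{y : E | (1/2 : ℝ) < inner ℝ v y} ∩ Metric.sphere 0 1, Filter.inter_mem (mem_nhdsWithin_of_mem_nhds hU) self_mem_nhdsWithin, ?_⟩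
  have hsub : {y : E | (1/2 : ℝ) < inner ℝ v y} ∩ Metric.sphere 0 1 ⊆ φ '' Metric.closedBall 0 3 := by
    rintro y ⟨hy, hy1⟩
    have hy1 : ‖y‖ = 1 := by simpa using hy1
    simp only [Set.mem_ofPred_eq] at hy
    set t := inner ℝ v y with ht
    have ht0 : t ≠ 0 := by linarith
    have hmem : t⁻¹ • y - v ∈ W := by
      refine Submodule.mem_orthogonal_singleton_iff_inner_right.2 ?_
      rw [inner_sub_right, inner_smul_right, real_inner_self_eq_norm_sq, hv1, ← ht]
      field_simp; norm_num
    refine ⟨⟨_, hmem⟩, ?_, ?_⟩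
    · rw [mem_closedBall_zero_iff]
      change ‖t⁻¹ • y - v‖ ≤ 3
      refine (norm_sub_le _ _).trans ?_
      rw [norm_smul, hy1, hv1, norm_inv, Real.norm_eq_abs, abs_of_pos (by linarith)]
      have : t⁻¹ ≤ (1/2)⁻¹ := inv_anti₀ (by norm_num) hy.le
      norm_num at this ⊢; linarith
    · change (‖v + (t⁻¹ • y - v)‖)⁻¹ • (v + (t⁻¹ • y - v)) = y
      rw [add_sub_cancel, norm_smul, hy1, norm_inv, Real.norm_eq_abs, abs_of_pos (by linarith),
        smul_smul]
      simp [ht0]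
  refine (measure_mono hsub).trans_lt ?_
  refine (hφ.hausdorffMeasure_image_le (by positivity) _).trans_lt ?_
  refine ENNReal.mul_lt_top (by simp) ?_
  have : Measure.IsAddHaarMeasure (μH[(d : ℝ)] : Measure W) := by
    rw [← hW]; infer_instance
  exact (isCompact_closedBall _ _).measure_lt_top

theorem sphere_pos {E : Type*} [NormedAddCommGroup E] [InnerProductSpace ℝ E]
    [FiniteDimensional ℝ E] [MeasurableSpace E] [BorelSpace E] (d : ℕ)
    (hd : Module.finrank ℝ E = d + 1) :
    0 < μH[(d : ℝ)] (Metric.sphere (0 : E) 1) := by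
  have : Fact (Module.finrank ℝ E = d + 1) := ⟨hd⟩
  have : Nontrivial E := Module.nontrivial_of_finrank_pos (R := ℝ) (by omega)
  obtain ⟨v, hv1⟩ := exists_norm_eq E (zero_le_one (α := ℝ))
  have hv0 : v ≠ 0 := by rintro rfl; simp at hv1
  let W := (Submodule.span ℝ {v})ᗮ
  have hW : Module.finrank ℝ W = d := Submodule.finrank_orthogonal_span_singleton hv0
  have horth : ∀ w : W, inner ℝ v (w : E) = 0 := fun w =>
    Submodule.mem_orthogonal_singleton_iff_inner_right.1 w.2
  have : Measure.IsAddHaarMeasure (μH[(d : ℝ)] : Measure W) := by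
    rw [← hW]; infer_instance
  have hL : LipschitzWith 1 (W.orthogonalProjectionOnto : E → W) := by
    refine LipschitzWith.of_dist_le_mul fun x y => ?_
    rw [dist_eq_norm, dist_eq_norm, ← map_sub]
    simpa using W.norm_orthogonalProjectionOnto_apply_le (x - y)
  have hsub : Metric.ball (0 : W) 1 ⊆ W.orthogonalProjectionOnto '' Metric.sphere (0 : E) 1 := by
    intro w hw
    have hw : ‖w‖ < 1 := by simpa using hw
    have hw' : 0 ≤ 1 - ‖w‖^2 := by nlinarith [norm_nonneg w]
    refine ⟨Real.sqrt (1 - ‖w‖^2) • v + (w : E), ?_, ?_⟩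
    · rw [mem_sphere_zero_iff_norm]
      have : ‖Real.sqrt (1 - ‖w‖^2) • v + (w : E)‖ ^ 2 = 1 := by
        rw [norm_add_sq_real, inner_smul_left, horth, norm_smul, hv1, mul_pow, Real.norm_eq_abs,
          sq_abs, Real.sq_sqrt hw']
        simp
      nlinarith [norm_nonneg (Real.sqrt (1 - ‖w‖^2) • v + (w : E))]
    · rw [map_add, map_smul]
      have : W.orthogonalProjectionOnto v = 0 := by
        apply Submodule.orthogonalProjectionOnto_apply_of_mem_orthogonal
        exact Submodule.le_orthogonal_orthogonal _ (Submodule.mem_span_singleton_self v)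
      rw [this]
      simp
  have h1 := (measure_mono hsub).trans (hL.hausdorffMeasure_image_le (d := (d : ℝ)) (by positivity) _)
  have h2 : 0 < μH[(d : ℝ)] (Metric.ball (0 : W) 1) := Metric.measure_ball_pos _ _ one_pos
  simpa using h2.trans_le h1

section moments

variable {V : Type*} [NormedAddCommGroup V] [InnerProductSpace ℂ V]
    [FiniteDimensional ℂ V] [MeasurableSpace V] [BorelSpace V]

/-- Fourth moments of a measure. -/
noncomputable def mom (μ : Measure V) (x y u w : V) : ℂ :=
  ∫ z, inner ℂ x z * inner ℂ z y * inner ℂ u z * inner ℂ z w ∂μ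

theorem mom_integrable (μ : Measure V) [IsFiniteMeasure μ] (h1 : ∀ᵐ z ∂μ, ‖z‖ = 1) (x y u w : V) :
    Integrable (fun z => inner ℂ x z * inner ℂ z y * inner ℂ u z * inner ℂ z w) μ := by
  have : FiniteDimensional ℝ V := FiniteDimensional.complexToReal V
  have : ProperSpace V := FiniteDimensional.proper ℂ V
  refine Integrable.of_bound (C := ‖x‖ * ‖y‖ * ‖u‖ * ‖w‖) ?_ ?_
  · exact Continuous.aestronglyMeasurable (by fun_prop)
  · filter_upwards [h1] with z hz
    rw [norm_mul, norm_mul, norm_mul]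
    have a1 : ‖(inner ℂ x z : ℂ)‖ ≤ ‖x‖ := by simpa [hz] using norm_inner_le_norm (𝕜 := ℂ) x z
    have a2 : ‖(inner ℂ z y : ℂ)‖ ≤ ‖y‖ := by simpa [hz] using norm_inner_le_norm (𝕜 := ℂ) z y
    have a3 : ‖(inner ℂ u z : ℂ)‖ ≤ ‖u‖ := by simpa [hz] using norm_inner_le_norm (𝕜 := ℂ) u z
    have a4 : ‖(inner ℂ z w : ℂ)‖ ≤ ‖w‖ := by simpa [hz] using norm_inner_le_norm (𝕜 := ℂ) z w
    gcongr

theorem mom_add1 (μ : Measure V) [IsFiniteMeasure μ] (h1 : ∀ᵐ z ∂μ, ‖z‖ = 1) (x x' y u w : V) :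
    mom μ (x + x') y u w = mom μ x y u w + mom μ x' y u w := by
  unfold mom
  rw [← integral_add (mom_integrable μ h1 _ _ _ _) (mom_integrable μ h1 _ _ _ _)]
  congr 1; ext z; rw [inner_add_left]; ring

theorem mom_add2 (μ : Measure V) [IsFiniteMeasure μ] (h1 : ∀ᵐ z ∂μ, ‖z‖ = 1) (x y y' u w : V) :
    mom μ x (y + y') u w = mom μ x y u w + mom μ x y' u w := by
  unfold mom
  rw [← integral_add (mom_integrable μ h1 _ _ _ _) (mom_integrable μ h1 _ _ _ _)]
  congr 1; ext z; rw [inner_add_right]; ring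

theorem mom_swap13 (μ : Measure V) (x y u w : V) : mom μ x y u w = mom μ u y x w := by
  unfold mom; congr 1; ext z; ring

theorem mom_swap24 (μ : Measure V) (x y u w : V) : mom μ x y u w = mom μ x w u y := by
  unfold mom; congr 1; ext z; ring

theorem mom_smul (μ : Measure V) (a b c d : ℂ) (x y u w : V) :
    mom μ (a • x) (b • y) (c • u) (d • w) =
      starRingEnd ℂ a * b * starRingEnd ℂ c * d * mom μ x y u w := by
  unfold mom; rw [← integral_const_mul]
  congr 1; ext z; simp only [inner_smul_left, inner_smul_right]; ring

theorem mom_map (μ : Measure V) (hU : ∀ U : V ≃ₗᵢ[ℂ] V, MeasurePreserving U μ μ)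
    (U : V ≃ₗᵢ[ℂ] V) (x y u w : V) : mom μ (U x) (U y) (U u) (U w) = mom μ x y u w := by
  unfold mom
  rw [← (hU U).integral_comp U.toHomeomorph.measurableEmbedding]
  simp only [LinearIsometryEquiv.inner_map_map]

variable {n : ℕ}

theorem exists_phase (e : OrthonormalBasis (Fin n) ℂ V) (m : Fin n) :
    ∃ U : V ≃ₗᵢ[ℂ] V, ∀ k, U (e k) = (if k = m then Complex.I else 1) • e k := by
  have ho : Orthonormal ℂ (fun k => (if k = m then Complex.I else (1:ℂ)) • e k) := by
    rw [orthonormal_iff_ite]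
    intro i j
    rw [inner_smul_left, inner_smul_right, orthonormal_iff_ite.1 e.orthonormal]
    split_ifs <;> simp_all
  have hc : Module.finrank ℂ V = Fintype.card (Fin n) := Module.finrank_eq_card_basis e.toBasis
  obtain ⟨b, hb⟩ := Orthonormal.exists_orthonormalBasis_extension_of_card_eq hc
    (v := (fun k => (if k = m then Complex.I else (1:ℂ)) • e k)) (s := Set.univ)
    (ho.comp _ Subtype.val_injective)
  refine ⟨e.equiv b (Equiv.refl _), fun k => ?_⟩
  simp [hb k]

theorem exists_move (e : OrthonormalBasis (Fin n) ℂ V) (m : Fin n) (v : V) (hv : ‖v‖ = 1) :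
    ∃ U : V ≃ₗᵢ[ℂ] V, U (e m) = v := by
  have hc : Module.finrank ℂ V = Fintype.card (Fin n) := Module.finrank_eq_card_basis e.toBasis
  obtain ⟨b, hb⟩ := Orthonormal.exists_orthonormalBasis_extension_of_card_eq (𝕜 := ℂ) hc
    (v := (fun _ => v)) (s := {m}) ⟨fun i => by simpa using hv, fun i j hij =>
      absurd (Subsingleton.elim i j) hij⟩
  refine ⟨e.equiv b (Equiv.refl _), ?_⟩
  simp [hb m]

theorem mom_zero_of (μ : Measure V) (hU : ∀ U : V ≃ₗᵢ[ℂ] V, MeasurePreserving U μ μ)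
    (e : OrthonormalBasis (Fin n) ℂ V) (i j k l : Fin n)
    (h : ¬ ((i = j ∧ k = l) ∨ (i = l ∧ k = j))) : mom μ (e i) (e j) (e k) (e l) = 0 := by
  have key : ∀ m, mom μ (e i) (e j) (e k) (e l) =
      (starRingEnd ℂ (if i = m then Complex.I else 1) * (if j = m then Complex.I else 1) *
        starRingEnd ℂ (if k = m then Complex.I else 1) * (if l = m then Complex.I else 1)) *
        mom μ (e i) (e j) (e k) (e l) := fun m => by
    obtain ⟨U, hm⟩ := exists_phase e m
    have := mom_map μ hU U (e i) (e j) (e k) (e l)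
    rw [hm, hm, hm, hm, mom_smul] at this
    exact this.symm
  have fin : ∀ (c t : ℂ), t = c * t → c ≠ 1 → t = 0 := by
    intro c t h1 h2
    have : (c - 1) * t = 0 := by linear_combination -h1
    rcases mul_eq_zero.1 this with h | h
    · exact absurd (sub_eq_zero.1 h) h2
    · exact h
  have hI : -Complex.I ≠ 1 := by
    intro h; have := congrArg Complex.re h; simp at this
  have hI' : Complex.I ≠ 1 := by
    intro h; have := congrArg Complex.re h; simp at this
  by_cases hij : i = j
  · have hkl : k ≠ l := fun h' => h (Or.inl ⟨hij, h'⟩)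
    refine fin _ _ (key k) ?_
    subst hij
    by_cases hik : i = k <;> simp [hik, hkl.symm, hI]
  · by_cases hil : i = l
    · have hkj : k ≠ j := fun h' => h (Or.inr ⟨hil, h'⟩)
      refine fin _ _ (key k) ?_
      subst hil
      by_cases hik : i = k <;> simp [hik, hkj.symm, hI]
    · refine fin _ _ (key i) ?_
      by_cases hik : k = i
      · simp [hik, Ne.symm hij, Ne.symm hil]; norm_num
      · simp [hik, Ne.symm hij, Ne.symm hil, hI]

theorem mom_diag (μ : Measure V) [IsFiniteMeasure μ] (h1 : ∀ᵐ z ∂μ, ‖z‖ = 1)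
    (hU : ∀ U : V ≃ₗᵢ[ℂ] V, MeasurePreserving U μ μ)
    (e : OrthonormalBasis (Fin n) ℂ V) (i j : Fin n) :
    mom μ (e i) (e i) (e i) (e i) = mom μ (e j) (e j) (e j) (e j) := by
  obtain ⟨U, h⟩ := exists_move e j (e i) (by simp)
  rw [← mom_map μ hU U (e j), h]

theorem mom_offdiag (μ : Measure V) [IsFiniteMeasure μ] (h1 : ∀ᵐ z ∂μ, ‖z‖ = 1)
    (hU : ∀ U : V ≃ₗᵢ[ℂ] V, MeasurePreserving U μ μ)
    (e : OrthonormalBasis (Fin n) ℂ V) (i j : Fin n) (hij : i ≠ j) :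
    mom μ (e i) (e i) (e i) (e i) = 2 * mom μ (e i) (e i) (e j) (e j) := by
  have hn : ‖((Real.sqrt 2 : ℂ)⁻¹) • (e i + e j)‖ = 1 := by
    have hs : ‖e i + e j‖ ^ 2 = 2 := by
      rw [@norm_add_sq ℂ, orthonormal_iff_ite.1 e.orthonormal]
      simp [hij]; norm_num
    have hs' : ‖e i + e j‖ = Real.sqrt 2 := by
      rw [← hs, Real.sqrt_sq (norm_nonneg _)]
    rw [norm_smul, hs', norm_inv, Complex.norm_real, Real.norm_eq_abs,
      abs_of_nonneg (Real.sqrt_nonneg _)]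
    exact inv_mul_cancel₀ (by positivity)
  obtain ⟨U, h⟩ := exists_move e i _ hn
  have h2 := mom_map μ hU U (e i) (e i) (e i) (e i)
  have add3 : ∀ x y u u' w : V, mom μ x y (u + u') w = mom μ x y u w + mom μ x y u' w := by
    intro x y u u' w
    rw [mom_swap13, mom_add1 μ h1, mom_swap13, mom_swap13 μ u']
  have add4 : ∀ x y u w w' : V, mom μ x y u (w + w') = mom μ x y u w + mom μ x y u w' := by
    intro x y u w w'
    rw [mom_swap24, mom_add2 μ h1, mom_swap24, mom_swap24 μ x w']
  have hc : (starRingEnd ℂ) ((Real.sqrt 2 : ℂ)⁻¹) = (Real.sqrt 2 : ℂ)⁻¹ := by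
    rw [map_inv₀, Complex.conj_ofReal]
  have h4 : (Real.sqrt 2 : ℂ)⁻¹ * (Real.sqrt 2 : ℂ)⁻¹ = 1/2 := by
    rw [← mul_inv, ← Complex.ofReal_mul, Real.mul_self_sqrt (by norm_num)]; norm_num
  have h5 : (Real.sqrt 2 : ℂ)⁻¹ * (Real.sqrt 2 : ℂ)⁻¹ * (Real.sqrt 2 : ℂ)⁻¹ * (Real.sqrt 2 : ℂ)⁻¹
    = 1/4 := by
    rw [mul_assoc, h4]; norm_num [h4]
  rw [h, mom_smul, hc, h5] at h2
  simp only [mom_add1 μ h1, mom_add2 μ h1, add3, add4] at h2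
  have hji := hij.symm
  have z := mom_zero_of μ hU e
  rw [z i i i j (by simp [hij, hji]), z i i j i (by simp [hij, hji]),
    z i j i i (by simp [hij, hji]), z j i i i (by simp [hij, hji]),
    z j j j i (by simp [hij, hji]), z j j i j (by simp [hij, hji]),
    z j i j j (by simp [hij, hji]), z i j j j (by simp [hij, hji]),
    z i j i j (by simp [hij, hji]), z j i j i (by simp [hij, hji]),
    mom_swap13 μ (e j) (e i) (e i) (e j), mom_swap24 μ (e i) (e j) (e j) (e i),
    mom_swap13 μ (e j) (e j) (e i) (e i), mom_swap24 μ (e i) (e j) (e j) (e i),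
    ← mom_diag μ h1 hU e i j] at h2
  linear_combination -2 * h2

theorem mom_eq (μ : Measure V) [IsFiniteMeasure μ] (h1 : ∀ᵐ z ∂μ, ‖z‖ = 1)
    (hU : ∀ U : V ≃ₗᵢ[ℂ] V, MeasurePreserving U μ μ)
    (e : OrthonormalBasis (Fin n) ℂ V) (o i j k l : Fin n) :
    mom μ (e i) (e j) (e k) (e l) = (mom μ (e o) (e o) (e o) (e o) / 2) *
      ((if j = i then (if l = k then 1 else 0) else 0) +
        (if l = i then (if j = k then 1 else 0) else 0)) := by
  by_cases h : (i = j ∧ k = l) ∨ (i = l ∧ k = j)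
  · rw [mom_diag μ h1 hU e o i]
    by_cases hik : i = k
    · subst hik
      rcases h with ⟨rfl, rfl⟩ | ⟨rfl, rfl⟩ <;> simp <;> ring
    · rw [mom_offdiag μ h1 hU e i k hik]
      rcases h with ⟨rfl, rfl⟩ | ⟨rfl, rfl⟩
      · simp [hik, Ne.symm hik]
      · rw [mom_swap24]; simp [hik, Ne.symm hik]
  · rw [mom_zero_of μ hU e i j k l h]
    have : ((if j = i then (if l = k then 1 else 0) else 0) +
        (if l = i then (if j = k then 1 else 0) else 0) : ℂ) = 0 := by
      split_ifs <;> simp_all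
    rw [this, mul_zero]

theorem mom_total (μ : Measure V) [IsFiniteMeasure μ] (h1 : ∀ᵐ z ∂μ, ‖z‖ = 1)
    (hU : ∀ U : V ≃ₗᵢ[ℂ] V, MeasurePreserving U μ μ)
    (e : OrthonormalBasis (Fin n) ℂ V) (o : Fin n) :
    (mom μ (e o) (e o) (e o) (e o) / 2) * (n * (n + 1)) = (μ.real Set.univ : ℂ) := by
  have a : ∑ i, ∑ k, mom μ (e i) (e i) (e k) (e k) = (μ.real Set.univ : ℂ) := by
    unfold mom
    simp_rw [← integral_finsetSum Finset.univ (fun k _ => mom_integrable μ h1 _ _ (e k) (e k))]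
    rw [← integral_finsetSum _ (fun i _ => integrable_finsetSum _
      (fun k _ => mom_integrable μ h1 _ _ (e k) (e k)))]
    have : ∀ᵐ z ∂μ, ∑ i, ∑ k, inner ℂ (e i) z * inner ℂ z (e i) * inner ℂ (e k) z * inner ℂ z (e k)
        = (1 : ℂ) := by
      filter_upwards [h1] with z hz
      have hs : ∑ i, inner ℂ (e i) z * inner ℂ z (e i) = (1 : ℂ) := by
        have := e.sum_inner_mul_inner z z
        rw [inner_self_eq_norm_sq_to_K, hz] at this
        simpa [mul_comm] using this
      have : ∀ i k, inner ℂ (e i) z * inner ℂ z (e i) * inner ℂ (e k) z * inner ℂ z (e k)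
        = (inner ℂ (e i) z * inner ℂ z (e i)) * (inner ℂ (e k) z * inner ℂ z (e k) : ℂ) :=
        fun i k => by ring
      simp_rw [this, ← Finset.mul_sum, hs, mul_one, hs]
    rw [integral_congr_ae this]
    simp
  rw [← a]
  have hk : ∀ i k, mom μ (e i) (e i) (e k) (e k) = (mom μ (e o) (e o) (e o) (e o) / 2) *
      (1 + if k = i then 1 else 0) := by
    intro i k
    rw [mom_eq μ h1 hU e o i i k k]
    by_cases h : k = i
    · simp [h]
    · simp [h]
  rw [Finset.sum_congr rfl fun i _ => Finset.sum_congr rfl fun k _ => hk i k]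
  simp_rw [← Finset.mul_sum, Finset.sum_add_distrib]
  simp
  left
  ring

theorem kahler_expand {R : V → V → V → V → ℂ} (hR : IsKahlerCurvature R)
    (e : OrthonormalBasis (Fin n) ℂ V) (z : V) :
    R z z z z = ∑ i, ∑ j, ∑ k, ∑ l, R (e i) (e j) (e k) (e l) *
      (inner ℂ (e i) z * inner ℂ z (e j) * inner ℂ (e k) z * inner ℂ z (e l)) := by
  have L1 : ∀ Y Z W, R z Y Z W = ∑ i, inner ℂ (e i) z * R (e i) Y Z W := by
    intro Y Z W
    let f := (hR.linear_fst Y Z W).mk'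
    have : f z = ∑ i, inner ℂ (e i) z * f (e i) := by
      conv_lhs => rw [← e.sum_repr' z, map_sum]
      simp only [map_smul, smul_eq_mul]
    exact this
  have L2 : ∀ X Z W, R X z Z W = ∑ i, inner ℂ z (e i) * R X (e i) Z W := by
    intro X Z W
    rw [hR.conj_symm, L1, map_sum]
    refine Finset.sum_congr rfl fun i _ => ?_
    rw [map_mul, inner_conj_symm, ← hR.conj_symm]
  have L3 : ∀ X Y W, R X Y z W = ∑ i, inner ℂ (e i) z * R X Y (e i) W := by
    intro X Y W
    rw [hR.symm_fst_trd, L1]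
    exact Finset.sum_congr rfl fun i _ => by rw [hR.symm_fst_trd]
  have L4 : ∀ X Y Z, R X Y Z z = ∑ i, inner ℂ z (e i) * R X Y Z (e i) := by
    intro X Y Z
    rw [hR.symm_snd_fourth, L2]
    exact Finset.sum_congr rfl fun i _ => by rw [hR.symm_snd_fourth]
  rw [L1]
  refine Finset.sum_congr rfl fun i _ => ?_
  rw [L2, Finset.mul_sum]
  refine Finset.sum_congr rfl fun j _ => ?_
  rw [L3, Finset.mul_sum, Finset.mul_sum]
  refine Finset.sum_congr rfl fun k _ => ?_
  rw [L4, Finset.mul_sum, Finset.mul_sum, Finset.mul_sum]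
  refine Finset.sum_congr rfl fun l _ => ?_
  ring

theorem integrable_kahler {R : V → V → V → V → ℂ} (hR : IsKahlerCurvature R)
    (μ : Measure V) [IsFiniteMeasure μ] (h1 : ∀ᵐ z ∂μ, ‖z‖ = 1)
    (e : OrthonormalBasis (Fin n) ℂ V) : Integrable (fun z => R z z z z) μ := by
  simp_rw [kahler_expand hR e]
  exact integrable_finsetSum _ fun i _ => integrable_finsetSum _ fun j _ =>
    integrable_finsetSum _ fun k _ => integrable_finsetSum _ fun l _ =>
    (mom_integrable μ h1 _ _ _ _).const_mul _

theorem integral_kahler {R : V → V → V → V → ℂ} (hR : IsKahlerCurvature R)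
    (μ : Measure V) [IsFiniteMeasure μ] (h1 : ∀ᵐ z ∂μ, ‖z‖ = 1)
    (hU : ∀ U : V ≃ₗᵢ[ℂ] V, MeasurePreserving U μ μ)
    (e : OrthonormalBasis (Fin n) ℂ V) (o : Fin n) :
    ∫ z, R z z z z ∂μ = mom μ (e o) (e o) (e o) (e o) *
      ∑ i, ∑ j, R (e i) (e i) (e j) (e j) := by
  have hi : ∀ i j k l, Integrable (fun z => R (e i) (e j) (e k) (e l) *
      (inner ℂ (e i) z * inner ℂ z (e j) * inner ℂ (e k) z * inner ℂ z (e l))) μ :=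
    fun i j k l => (mom_integrable μ h1 _ _ _ _).const_mul _
  have : ∫ z, R z z z z ∂μ = ∑ i, ∑ j, ∑ k, ∑ l, R (e i) (e j) (e k) (e l) *
      mom μ (e i) (e j) (e k) (e l) := by
    simp_rw [kahler_expand hR e]
    rw [integral_finsetSum _ fun i _ => integrable_finsetSum _ fun j _ =>
      integrable_finsetSum _ fun k _ => integrable_finsetSum _ fun l _ => hi i j k l]
    refine Finset.sum_congr rfl fun i _ => ?_
    rw [integral_finsetSum _ fun j _ =>
      integrable_finsetSum _ fun k _ => integrable_finsetSum _ fun l _ => hi i j k l]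
    refine Finset.sum_congr rfl fun j _ => ?_
    rw [integral_finsetSum _ fun k _ => integrable_finsetSum _ fun l _ => hi i j k l]
    refine Finset.sum_congr rfl fun k _ => ?_
    rw [integral_finsetSum _ fun l _ => hi i j k l]
    refine Finset.sum_congr rfl fun l _ => ?_
    rw [integral_const_mul, mom]
  rw [this]
  have step : ∀ i k, ∑ j, ∑ l, R (e i) (e j) (e k) (e l) * mom μ (e i) (e j) (e k) (e l)
      = mom μ (e o) (e o) (e o) (e o) * R (e i) (e i) (e k) (e k) := by
    intro i k
    simp_rw [mom_eq μ h1 hU e o i _ k _, mul_add, Finset.sum_add_distrib]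
    have q : R (e i) (e k) (e k) (e i) = R (e i) (e i) (e k) (e k) := hR.symm_snd_fourth _ _ _ _
    have p1 : ∑ j, ∑ l, R (e i) (e j) (e k) (e l) * (mom μ (e o) (e o) (e o) (e o) / 2 *
        (if j = i then (if l = k then 1 else 0) else 0)) =
        R (e i) (e i) (e k) (e k) * (mom μ (e o) (e o) (e o) (e o) / 2) := by
      rw [Finset.sum_eq_single i, Finset.sum_eq_single k] <;> simp +contextual
    have p2 : ∑ j, ∑ l, R (e i) (e j) (e k) (e l) * (mom μ (e o) (e o) (e o) (e o) / 2 *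
        (if l = i then (if j = k then 1 else 0) else 0)) =
        R (e i) (e k) (e k) (e i) * (mom μ (e o) (e o) (e o) (e o) / 2) := by
      rw [Finset.sum_eq_single k, Finset.sum_eq_single i] <;> simp +contextual
    rw [p1, p2, q]; ring
  simp_rw [Finset.mul_sum]
  refine Finset.sum_congr rfl fun i _ => ?_
  rw [Finset.sum_comm]
  exact Finset.sum_congr rfl fun k _ => step i k

end moments

/-- **Berger's identity.** For a Kähler-type curvature tensor `R` on an
`n`-dimensional complex inner product space, the scalar curvature
`S = ∑_{i,j} R(eᵢ, ēᵢ, eⱼ, ēⱼ)` (for a unitary basis `{eᵢ}`) satisfies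
`S = n(n+1)/(2 Vol(S^{2n-1})) ∫_{|Z|=1} H(Z) dθ(Z)` where `H(Z) = R(Z,Z̄,Z,Z̄)` and the
integral is with respect to the standard `(2n-1)`-dimensional Hausdorff measure on the unit
sphere of `V`. -/
theorem stmt_0 {V : Type*} [NormedAddCommGroup V] [InnerProductSpace ℂ V]
    [FiniteDimensional ℂ V] [MeasurableSpace V] [BorelSpace V]
    (n : ℕ) (hn : 1 ≤ n) (hrank : Module.finrank ℂ V = n)
    (R : V → V → V → V → ℂ) (hR : IsKahlerCurvature R)
    (e : OrthonormalBasis (Fin n) ℂ V) :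
    (∑ i : Fin n, ∑ j : Fin n, (R (e i) (e i) (e j) (e j)).re)
      = ((n : ℝ) * ((n : ℝ) + 1)) /
          (2 * (μH[(2 * (n : ℝ) - 1)] (Metric.sphere (0 : V) 1)).toReal) *
        ∫ Z in Metric.sphere (0 : V) 1, (R Z Z Z Z).re ∂(μH[(2 * (n : ℝ) - 1)]) := by
  have o : Fin n := ⟨0, hn⟩
  letI : InnerProductSpace ℝ V := InnerProductSpace.complexToReal
  have : FiniteDimensional ℝ V := FiniteDimensional.complexToReal V
  have hd : Module.finrank ℝ V = (2 * n - 1) + 1 := by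
    rw [finrank_real_of_complex, hrank]; omega
  have hcast : ((2 * n - 1 : ℕ) : ℝ) = 2 * (n : ℝ) - 1 := by
    rw [Nat.cast_sub (by omega)]; push_cast; ring
  have hlt := sphere_lt_top (2 * n - 1) hd
  have hpos := sphere_pos (2 * n - 1) hd
  rw [hcast] at hlt hpos
  set μ : Measure V := (μH[(2 * (n : ℝ) - 1)]).restrict (Metric.sphere (0 : V) 1) with hμ
  have hfin : IsFiniteMeasure μ := ⟨by simpa [hμ] using hlt⟩
  have h1 : ∀ᵐ z ∂μ, ‖z‖ = 1 := by
    filter_upwards [ae_restrict_mem Metric.isClosed_sphere.measurableSet] with z hz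
    simpa using hz
  have hU : ∀ U : V ≃ₗᵢ[ℂ] V, MeasurePreserving U μ μ := by
    intro U
    have h := (U.toIsometryEquiv.measurePreserving_hausdorffMeasure
      (2 * (n : ℝ) - 1)).restrict_preimage
      (Metric.isClosed_sphere (x := (0 : V)) (ε := 1)).measurableSet
    have hp : U.toIsometryEquiv ⁻¹' (Metric.sphere (0 : V) 1) = Metric.sphere (0 : V) 1 := by
      ext z; simp
    rw [hp] at h
    exact h
  have ht := mom_total μ h1 hU e o
  have hi := integral_kahler hR μ h1 hU e o
  have hre : ∫ z, (R z z z z).re ∂μ = (∫ z, R z z z z ∂μ).re :=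
    integral_re (integrable_kahler hR μ h1 e)
  have hσ : μ.real Set.univ = (μH[(2 * (n : ℝ) - 1)] (Metric.sphere (0 : V) 1)).toReal := by
    simp [hμ, Measure.real]
  have hσ0 : 0 < μ.real Set.univ := by
    rw [hσ]; exact ENNReal.toReal_pos hpos.ne' hlt.ne
  rw [hre, ← hσ, hi]
  have hn0 : (0 : ℝ) < n := by exact_mod_cast hn
  have hnn : ((n : ℂ) * (n + 1)) ≠ 0 := by
    have : ((n : ℝ) * (n + 1)) ≠ 0 := by positivity
    exact_mod_cast this
  have hm : mom μ (e o) (e o) (e o) (e o) =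
      ((2 * μ.real Set.univ / (n * (n + 1)) : ℝ) : ℂ) := by
    push_cast
    rw [eq_div_iff hnn, ← ht]; ring
  rw [hm, Complex.re_ofReal_mul]
  simp only [Complex.re_sum]
  field_simp
end

section
/- Let V be an n-dimensional complex inner product space with Kähler form ω, α a real (1,1)-form on V, and η a (p,0)-form with associated semipositive (1,1)-form β = Λ^{p-1}((√-1)^{p²}η∧η̄/p!), where p+1 ≤ n. Then (√-1)^{p²}·α ∧ η ∧ η̄ ∧ ω^{n-p-1}/(n-p-1)! = [tr_ω(α)·|η|² − p·⟨α,β⟩]·ω^n/n!, as an equality of (n,n)-forms (i.e., top-degree forms) on V. -/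
noncomputable section

/-- The wedge product of two complex-valued alternating forms (over scalars `𝕜 = ℝ` or `ℂ`),
obtained from `AlternatingMap.domCoprod` followed by multiplication `ℂ ⊗ ℂ → ℂ`. -/
def wedgeAM {𝕜 V : Type*} [CommRing 𝕜] [Algebra 𝕜 ℂ] [AddCommGroup V] [Module 𝕜 V]
    {a b : ℕ} (f : V [⋀^Fin a]→ₗ[𝕜] ℂ) (g : V [⋀^Fin b]→ₗ[𝕜] ℂ) :
    V [⋀^Fin (a + b)]→ₗ[𝕜] ℂ :=
  ((LinearMap.mul' 𝕜 ℂ).compAlternatingMap (f.domCoprod g)).domDomCongr finSumFinEquiv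

variable {V : Type*} [NormedAddCommGroup V] [InnerProductSpace ℂ V]

/-- A complex `p`-multilinear alternating form, viewed as an `ℝ`-multilinear one. -/
def altRestrict {p : ℕ} (η : V [⋀^Fin p]→ₗ[ℂ] ℂ) : V [⋀^Fin p]→ₗ[ℝ] ℂ :=
  { η.toMultilinearMap.restrictScalars ℝ with
    map_eq_zero_of_eq' := fun v _i _j h hij => η.map_eq_zero_of_eq v h hij }

/-- The conjugate of a complex-valued `ℝ`-alternating form (conjugation of the values). -/
def conjAM {p : ℕ} (η : V [⋀^Fin p]→ₗ[ℝ] ℂ) : V [⋀^Fin p]→ₗ[ℝ] ℂ :=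
  (Complex.conjAe.toLinearMap).compAlternatingMap η

/-- The `(1,0)`-form `dz^i = ⟨e i, ·⟩` attached to a unitary basis, over `ℂ`. -/
def dzC {n : ℕ} (e : OrthonormalBasis (Fin n) ℂ V) (i : Fin n) : V [⋀^Fin 1]→ₗ[ℂ] ℂ :=
  AlternatingMap.ofSubsingleton ℂ V ℂ (0 : Fin 1) (innerSL ℂ (e i)).toLinearMap

/-- The `(1,0)`-form `dz^i` as an `ℝ`-alternating form. -/
def dz1 {n : ℕ} (e : OrthonormalBasis (Fin n) ℂ V) (i : Fin n) : V [⋀^Fin 1]→ₗ[ℝ] ℂ :=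
  altRestrict (dzC e i)

/-- The conjugate `(0,1)`-form `dz̄^i`. -/
def dz1bar {n : ℕ} (e : OrthonormalBasis (Fin n) ℂ V) (i : Fin n) : V [⋀^Fin 1]→ₗ[ℝ] ℂ :=
  conjAM (dz1 e i)

/-- The Kähler form `ω = √-1 ∑ᵢ dz^i ∧ dz̄^i` of the Hermitian inner product, in the
unitary basis `e`, as a complex-valued real-alternating 2-form. -/
def omegaForm {n : ℕ} (e : OrthonormalBasis (Fin n) ℂ V) : V [⋀^Fin 2]→ₗ[ℝ] ℂ :=
  Complex.I • ∑ i : Fin n, wedgeAM (dz1 e i) (dz1bar e i)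

/-- Wedge powers `ω^k` of the Kähler form. -/
def omegaPow {n : ℕ} (e : OrthonormalBasis (Fin n) ℂ V) : (k : ℕ) → V [⋀^Fin (2 * k)]→ₗ[ℝ] ℂ
  | 0 => AlternatingMap.constOfIsEmpty ℝ V (Fin 0) 1
  | k + 1 => (wedgeAM (omegaPow e k) (omegaForm e)).domDomCongr (finCongr (by omega))

/-- Wedge powers `σ^k` of a complex `(2,0)`-form. -/
def cpow (σ : V [⋀^Fin 2]→ₗ[ℂ] ℂ) : (k : ℕ) → V [⋀^Fin (2 * k)]→ₗ[ℂ] ℂ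
  | 0 => AlternatingMap.constOfIsEmpty ℂ V (Fin 0) 1
  | k + 1 => (wedgeAM (cpow σ k) σ).domDomCongr (finCongr (by omega))

/-- `z 0 ∧ z 1 ∧ ⋯ ∧ z (m-1)` for a sequence of complex `1`-forms. -/
def wedgeSeq (z : ℕ → (V [⋀^Fin 1]→ₗ[ℂ] ℂ)) : (m : ℕ) → V [⋀^Fin m]→ₗ[ℂ] ℂ
  | 0 => AlternatingMap.constOfIsEmpty ℂ V (Fin 0) 1
  | m + 1 => wedgeAM (wedgeSeq z m) (z m)

end

section alg
variable {M : Type*} [AddCommGroup M] [Module ℂ M] {n : ℕ}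

open ExteriorAlgebra in
/-- ordered product of vectors -/
noncomputable def zProd (z : Fin n → M) {P : ℕ} (f : Fin P → Fin n) : ExteriorAlgebra ℂ M :=
  ExteriorAlgebra.ιMulti ℂ P (fun l => z (f l))

theorem zProd_zero (z : Fin n → M) (f : Fin 0 → Fin n) : zProd z f = 1 := by
  simp [zProd, ExteriorAlgebra.ιMulti_apply]

theorem zProd_succ (z : Fin n → M) {P : ℕ} (f : Fin (P + 1) → Fin n) :
    zProd z f = ExteriorAlgebra.ι ℂ (z (f 0)) * zProd z (fun l => f l.succ) := by
  rw [zProd, ExteriorAlgebra.ιMulti_succ_apply]; rfl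

theorem zProd_cons (z : Fin n → M) {P : ℕ} (i : Fin n) (f : Fin P → Fin n) :
    zProd z (Fin.cons i f : Fin (P + 1) → Fin n) = ExteriorAlgebra.ι ℂ (z i) * zProd z f := by
  simp [zProd_succ]

theorem zProd_zero_of_lt (z : Fin n → M) {P : ℕ} (h : n < P) (f : Fin P → Fin n) :
    zProd z f = 0 := by
  obtain ⟨a, b, hab, hf⟩ := Fintype.exists_ne_map_eq_of_card_lt f (by simpa using h)
  exact AlternatingMap.map_eq_zero_of_eq _ _ (by simp [hf]) hab

theorem ι_anti (a b : M) : ExteriorAlgebra.ι ℂ a * ExteriorAlgebra.ι ℂ b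
    = - (ExteriorAlgebra.ι ℂ b * ExteriorAlgebra.ι ℂ a) :=
  eq_neg_of_add_eq_zero_left (ExteriorAlgebra.ι_add_mul_swap a b)

theorem ι_zProd_comm (a : M) (z : Fin n → M) {P : ℕ} (f : Fin P → Fin n) :
    ExteriorAlgebra.ι ℂ a * zProd z f = (-1 : ℂ) ^ P • (zProd z f * ExteriorAlgebra.ι ℂ a) := by
  induction P with
  | zero => simp [zProd_zero]
  | succ P ih =>
    rw [zProd_succ, ← mul_assoc, ι_anti, neg_mul, mul_assoc, ih, pow_succ]
    simp [mul_assoc]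

noncomputable def om (z w : Fin n → M) : ExteriorAlgebra ℂ M :=
  ∑ i, ExteriorAlgebra.ι ℂ (z i) * ExteriorAlgebra.ι ℂ (w i)

theorem ι_om (a : M) (z w : Fin n → M) : Commute (ExteriorAlgebra.ι ℂ a) (om z w) := by
  unfold om
  refine Commute.sum_right _ _ _ fun i _ => ?_
  show _ * _ = _ * _
  rw [← mul_assoc, ι_anti, neg_mul, mul_assoc, ι_anti a, mul_neg, neg_neg, mul_assoc]

theorem zProd_om_zero (z w : Fin n → M) (k : ℕ) : ∀ {P : ℕ} (_ : n < P + k) (f : Fin P → Fin n),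
    zProd z f * om z w ^ k = 0 := by
  induction k with
  | zero => intro P h f; rw [zProd_zero_of_lt z (by simpa using h)]; simp
  | succ k ih =>
    intro P h f
    rw [pow_succ', ← mul_assoc]
    conv_lhs => enter [1, 2]; unfold om
    rw [Finset.mul_sum, Finset.sum_mul]
    refine Finset.sum_eq_zero fun i _ => ?_
    have h1 := ih (P := P + 1) (by omega) (Fin.cons i f : Fin (P + 1) → Fin n)
    rw [zProd_cons, ι_zProd_comm] at h1
    have h2 : zProd z f * ExteriorAlgebra.ι ℂ (z i) * om z w ^ k = 0 := by
      rw [smul_mul_assoc] at h1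
      exact (smul_eq_zero.mp h1).resolve_left (by simp)
    rw [← mul_assoc, mul_assoc, ((ι_om (w i) z w).pow_right k).eq, ← mul_assoc, h2, zero_mul]

open CliffordAlgebra

/-- contraction -/
noncomputable def ctr (d : Module.Dual ℂ M) : ExteriorAlgebra ℂ M →ₗ[ℂ] ExteriorAlgebra ℂ M :=
  CliffordAlgebra.contractLeft (Q := (0 : QuadraticForm ℂ M)) d

theorem ctr_ι_mul (d : Module.Dual ℂ M) (a : M) (y : ExteriorAlgebra ℂ M) :
    ctr d (ExteriorAlgebra.ι ℂ a * y) = d a • y - ExteriorAlgebra.ι ℂ a * ctr d y :=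
  CliffordAlgebra.contractLeft_ι_mul d a y

theorem ctr_one (d : Module.Dual ℂ M) : ctr d 1 = 0 := CliffordAlgebra.contractLeft_one _ d

theorem ctr_om_pow (z w : Fin n → M) (d : Module.Dual ℂ M) (j : Fin n)
    (hz : ∀ i, d (z i) = if i = j then 1 else 0) (hw : ∀ i, d (w i) = 0) (k : ℕ) :
    ctr d (om z w ^ (k + 1)) = ((k : ℂ) + 1) • (ExteriorAlgebra.ι ℂ (w j) * om z w ^ k) := by
  have key : ∀ y, ctr d (om z w * y) = ExteriorAlgebra.ι ℂ (w j) * y + om z w * ctr d y := by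
    intro y
    conv_lhs => unfold om
    rw [Finset.sum_mul, map_sum]
    simp only [mul_assoc, ctr_ι_mul, hz, hw, zero_smul, zero_sub, mul_neg, sub_neg_eq_add]
    rw [Finset.sum_add_distrib]
    simp [om, Finset.sum_mul, mul_assoc]
  induction k with
  | zero => have := key 1; rw [mul_one, ctr_one] at this; simp [this]
  | succ k ih =>
    rw [pow_succ', key, ih, mul_smul_comm, ← mul_assoc, ← (ι_om (w j) z w).eq, mul_assoc,
      ← pow_succ']
    push_cast
    module

theorem ctr_wProd (w : Fin n → M) (d : Module.Dual ℂ M) (hw : ∀ i, d (w i) = 0) {P : ℕ}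
    (g : Fin P → Fin n) (y : ExteriorAlgebra ℂ M) :
    ctr d (zProd w g * y) = (-1 : ℂ) ^ P • (zProd w g * ctr d y) := by
  induction P with
  | zero => simp [zProd_zero]
  | succ P ih =>
    rw [zProd_succ, mul_assoc, ctr_ι_mul, ih, hw, pow_succ]
    simp [mul_assoc]

theorem ctr_zProd (z : Fin n → M) (d : Module.Dual ℂ M) {P : ℕ}
    (f : Fin (P + 1) → Fin n) (y : ExteriorAlgebra ℂ M) :
    ctr d (zProd z f * y) = ∑ a : Fin (P + 1), ((-1 : ℂ) ^ (a : ℕ) * d (z (f a))) •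
        (zProd z (fun l => f (a.succAbove l)) * y)
      + (-1 : ℂ) ^ (P + 1) • (zProd z f * ctr d y) := by
  induction P with
  | zero => simp [zProd_zero, zProd_succ, ctr_ι_mul, sub_eq_add_neg]
  | succ P ih =>
    rw [zProd_succ, mul_assoc, ctr_ι_mul, ih, Fin.sum_univ_succ (n := P + 1)]
    simp only [Fin.succAbove_zero, mul_add, Finset.mul_sum, mul_smul_comm]
    have : ∀ a : Fin (P + 1), zProd z (fun l => f (a.succ.succAbove l))
        = ExteriorAlgebra.ι ℂ (z (f 0)) * zProd z (fun l => f (a.succAbove l).succ) := by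
      intro a
      rw [zProd_succ]; simp
    simp only [this, mul_assoc, Fin.val_succ, pow_succ, Fin.val_zero, pow_zero, one_mul,
      mul_neg_one, neg_mul, neg_smul, Finset.sum_neg_distrib]
    abel

noncomputable def sg : ℕ → ℂ
  | 0 => 1
  | P + 1 => (-1) ^ P * sg P

theorem sg_I (p : ℕ) : sg p * Complex.I ^ (p ^ 2) = Complex.I ^ p := by
  induction p with
  | zero => simp [sg]
  | succ p ih =>
    have : (p + 1) ^ 2 = p ^ 2 + 2 * p + 1 := by ring
    rw [this, pow_succ Complex.I, pow_succ Complex.I p, pow_add, pow_mul Complex.I 2, Complex.I_sq, ← ih, sg]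
    have h : ((-1 : ℂ) ^ p) * (-1) ^ p = 1 := by rw [← mul_pow]; simp
    linear_combination (sg p * Complex.I ^ (p ^ 2) * Complex.I) * h

noncomputable def dl {P : ℕ} (f g : Fin P → Fin n) : Matrix (Fin P) (Fin P) ℂ :=
  Matrix.of fun a b => if f a = g b then 1 else 0

theorem main_alg (z w : Fin n → M) (d : Fin n → Module.Dual ℂ M)
    (hz : ∀ j i, d j (z i) = if i = j then 1 else 0) (hw : ∀ j i, d j (w i) = 0) (P : ℕ) :
    ∀ (q : ℕ) (_ : P + q = n) (f g : Fin P → Fin n),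
      (n.factorial : ℂ) • (zProd z f * zProd w g * om z w ^ q)
        = (sg P * q.factorial * (dl f g).det) • om z w ^ n := by
  induction P with
  | zero => intro q h f g; obtain rfl : q = n := by omega
            simp [zProd_zero, sg]
  | succ P ih =>
    intro q h f g
    set j := g 0 with hj
    set g' : Fin P → Fin n := fun l => g l.succ with hg'
    have h0 : zProd z f * (zProd w g' * om z w ^ (q + 1)) = 0 := by
      have hc : Commute (zProd w g') (om z w ^ (q + 1)) := by
        have : ∀ {P : ℕ} (g : Fin P → Fin n), Commute (zProd w g) (om z w) := by
          intro P g
          induction P with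
          | zero => rw [zProd_zero]; exact Commute.one_left _
          | succ P ih => rw [zProd_succ]; exact (ι_om _ z w).mul_left (ih _)
        exact (this g').pow_right _
      rw [hc.eq, ← mul_assoc, zProd_om_zero z w (q + 1) (by omega), zero_mul]
    have h1 := congrArg (ctr (d j)) h0
    rw [ctr_zProd, ctr_wProd w (d j) (hw j), ctr_om_pow z w (d j) j (hz j) (hw j), map_zero] at h1
    have h2 : zProd z f * zProd w g * om z w ^ q
        = (-1 : ℂ) ^ P • (zProd z f * (zProd w g' * (ExteriorAlgebra.ι ℂ (w j) * om z w ^ q))) := by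
      rw [zProd_succ w g, ← hj, ← hg', ι_zProd_comm]
      simp [mul_assoc]
    have h3 : ((q : ℂ) + 1) • (zProd z f * (zProd w g' * (ExteriorAlgebra.ι ℂ (w j) * om z w ^ q)))
       = ∑ a : Fin (P + 1), ((-1 : ℂ) ^ (a : ℕ) * d j (z (f a))) •
        (zProd z (fun l => f (a.succAbove l)) * (zProd w g' * om z w ^ (q + 1))) := by
      rw [← sub_eq_zero, ← neg_eq_zero, ← h1, neg_sub, sub_eq_add_neg]
      congr 1
      simp only [mul_smul_comm, smul_smul, ← neg_smul]
      congr 1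
      have h : ((-1 : ℂ) ^ P) * (-1) ^ P = 1 := by rw [← mul_pow]; simp
      rw [pow_succ]
      linear_combination ((q : ℂ) + 1) * h
    have h4 : ∀ a : Fin (P + 1), (n.factorial : ℂ) •
        (zProd z (fun l => f (a.succAbove l)) * (zProd w g' * om z w ^ (q + 1)))
        = (sg P * (q + 1).factorial * (dl (fun l => f (a.succAbove l)) g').det) • om z w ^ n := by
      intro a
      rw [← ih (q + 1) (by omega), mul_assoc]
    have hq : ((q : ℂ) + 1) ≠ 0 := by exact_mod_cast Nat.succ_ne_zero q
    apply smul_right_injective _ hq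
    show ((q : ℂ) + 1) • _ = ((q : ℂ) + 1) • _
    have h5 : ((q : ℂ) + 1) • (n.factorial : ℂ) • (zProd z f * zProd w g * om z w ^ q)
       = (-1 : ℂ) ^ P • ((n.factorial : ℂ) • (((q : ℂ) + 1) • (zProd z f * (zProd w g' * (ExteriorAlgebra.ι ℂ (w j) * om z w ^ q))))) := by
      rw [h2]; module
    rw [h5, h3, Finset.smul_sum]
    simp only [smul_comm (n.factorial : ℂ), h4, smul_smul]
    rw [← Finset.sum_smul, smul_smul, Matrix.det_succ_column_zero]
    congr 1
    simp only [Finset.mul_sum, sg, hz, Nat.factorial_succ]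
    refine Finset.sum_congr rfl fun a _ => ?_
    have : (dl f g).submatrix a.succAbove Fin.succ = dl (fun l => f (a.succAbove l)) g' := by
      ext; simp [dl, hg']
    rw [this]
    simp only [dl, Matrix.of_apply, ← hj]
    push_cast
    ring
end alg
noncomputable section forms
variable {V : Type*} [NormedAddCommGroup V] [InnerProductSpace ℂ V]

def prodML {k : ℕ} (θ : Fin k → V →ₗ[ℝ] ℂ) : MultilinearMap ℝ (fun _ : Fin k => V) ℂ :=
  (MultilinearMap.mkPiAlgebra ℝ (Fin k) ℂ).compLinearMap θ

theorem alt_prodML_apply {k : ℕ} (θ : Fin k → V →ₗ[ℝ] ℂ) (v : Fin k → V) :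
    MultilinearMap.alternatization (prodML θ) v = ∑ σ : Equiv.Perm (Fin k),
      ((Equiv.Perm.sign σ : ℤ) : ℂ) * ∏ l, θ l (v (σ l)) := by
  rw [MultilinearMap.alternatization_apply]
  refine Finset.sum_congr rfl fun σ _ => ?_
  simp [prodML, Units.smul_def]

theorem alt_prodML_det {k : ℕ} (θ : Fin k → V →ₗ[ℝ] ℂ) (v : Fin k → V) :
    MultilinearMap.alternatization (prodML θ) v
      = Matrix.detRowAlternating (fun b a => θ b (v a)) := by
  rw [alt_prodML_apply]
  show _ = Matrix.det (Matrix.of fun b a => θ b (v a))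
  rw [← Matrix.det_transpose, Matrix.det_apply']
  rfl

/-- decomposable forms, as an alternating map of the one-forms -/
def decomp (k : ℕ) : (V →ₗ[ℝ] ℂ) [⋀^Fin k]→ₗ[ℂ] (V [⋀^Fin k]→ₗ[ℝ] ℂ) where
  toFun θ := MultilinearMap.alternatization (prodML θ)
  map_update_add' := by
    intro _ θ i x y
    ext v
    rw [AlternatingMap.add_apply]
    simp only [alt_prodML_det]
    have key : ∀ x : V →ₗ[ℝ] ℂ, (fun b a => (Function.update θ i x) b (v a))
        = Function.update (fun b a => θ b (v a)) i (fun a => x (v a)) := by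
      intro x; funext b a
      by_cases h : b = i
      · subst h; simp
      · simp [h]
    have inst : ‹DecidableEq (Fin k)› = instDecidableEqFin k := Subsingleton.elim _ _
    subst inst
    rw [key, key, key, ← AlternatingMap.map_update_add]
    rfl
  map_update_smul' := by
    intro _ θ i c x
    ext v
    rw [AlternatingMap.smul_apply]
    simp only [alt_prodML_det]
    have key : ∀ x : V →ₗ[ℝ] ℂ, (fun b a => (Function.update θ i x) b (v a))
        = Function.update (fun b a => θ b (v a)) i (fun a => x (v a)) := by
      intro x; funext b a
      by_cases h : b = i
      · subst h; simp
      · simp [h]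
    have inst : ‹DecidableEq (Fin k)› = instDecidableEqFin k := Subsingleton.elim _ _
    subst inst
    rw [key, key, ← AlternatingMap.map_update_smul]
    rfl
  map_eq_zero_of_eq' := by
    intro θ i j h hij
    ext v
    rw [AlternatingMap.zero_apply]
    simp only [alt_prodML_det]
    exact AlternatingMap.map_eq_zero_of_eq _ _ (by simp [h]) hij

theorem decomp_apply {k : ℕ} (θ : Fin k → V →ₗ[ℝ] ℂ) :
    decomp k θ = MultilinearMap.alternatization (prodML θ) := rfl

theorem wedge_decomp {a b : ℕ} (θ : Fin a → V →ₗ[ℝ] ℂ) (φ : Fin b → V →ₗ[ℝ] ℂ) :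
    wedgeAM (decomp a θ) (decomp b φ) = decomp (a + b) (Fin.append θ φ) := by
  ext v
  rw [decomp_apply, decomp_apply, decomp_apply, wedgeAM, ← MultilinearMap.domCoprod_alternization,
    alt_prodML_apply]
  rw [AlternatingMap.domDomCongr_apply, LinearMap.compAlternatingMap_apply,
    MultilinearMap.alternatization_apply, map_sum]
  refine Fintype.sum_equiv finSumFinEquiv.permCongr _ _ fun σ => ?_
  rw [Equiv.Perm.sign_permCongr, Fin.prod_univ_add]
  rcases Int.units_eq_one_or (Equiv.Perm.sign σ) with h | h <;> rw [h] <;> simp [prodML]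

theorem wedge_add_left {a b : ℕ} (f f' : V [⋀^Fin a]→ₗ[ℝ] ℂ) (g : V [⋀^Fin b]→ₗ[ℝ] ℂ) :
    wedgeAM (f + f') g = wedgeAM f g + wedgeAM f' g := by
  ext v
  simp [wedgeAM, ← AlternatingMap.domCoprod'_apply, TensorProduct.add_tmul]

theorem wedge_add_right {a b : ℕ} (f : V [⋀^Fin a]→ₗ[ℝ] ℂ) (g g' : V [⋀^Fin b]→ₗ[ℝ] ℂ) :
    wedgeAM f (g + g') = wedgeAM f g + wedgeAM f g' := by
  ext v
  simp [wedgeAM, ← AlternatingMap.domCoprod'_apply, TensorProduct.tmul_add]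

theorem wedge_apply {a b : ℕ} (f : V [⋀^Fin a]→ₗ[ℝ] ℂ) (g : V [⋀^Fin b]→ₗ[ℝ] ℂ)
    (v : Fin (a + b) → V) : wedgeAM f g v =
      ∑ σ : Equiv.Perm.ModSumCongr (Fin a) (Fin b),
        LinearMap.mul' ℝ ℂ (AlternatingMap.domCoprod.summand f g σ (v ∘ finSumFinEquiv)) := by
  rw [wedgeAM, AlternatingMap.domDomCongr_apply, LinearMap.compAlternatingMap_apply,
    AlternatingMap.domCoprod_apply, sum_apply, map_sum]

theorem wedge_smul_left {a b : ℕ} (c : ℂ) (f : V [⋀^Fin a]→ₗ[ℝ] ℂ) (g : V [⋀^Fin b]→ₗ[ℝ] ℂ) :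
    wedgeAM (c • f) g = c • wedgeAM f g := by
  ext v
  rw [AlternatingMap.smul_apply, wedge_apply, wedge_apply, Finset.smul_sum]
  refine Finset.sum_congr rfl fun σ _ => ?_
  induction σ using Quotient.inductionOn' with | h σ =>
  simp only [AlternatingMap.domCoprod.summand_mk'']
  rcases Int.units_eq_one_or (Equiv.Perm.sign σ) with h | h <;> rw [h] <;> simp <;> ring

theorem wedge_smul_right {a b : ℕ} (c : ℂ) (f : V [⋀^Fin a]→ₗ[ℝ] ℂ) (g : V [⋀^Fin b]→ₗ[ℝ] ℂ) :
    wedgeAM f (c • g) = c • wedgeAM f g := by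
  ext v
  rw [AlternatingMap.smul_apply, wedge_apply, wedge_apply, Finset.smul_sum]
  refine Finset.sum_congr rfl fun σ _ => ?_
  induction σ using Quotient.inductionOn' with | h σ =>
  simp only [AlternatingMap.domCoprod.summand_mk'']
  rcases Int.units_eq_one_or (Equiv.Perm.sign σ) with h | h <;> rw [h] <;> simp <;> ring

/-- realise exterior algebra elements as forms -/
def toForm (k : ℕ) : ExteriorAlgebra ℂ (V →ₗ[ℝ] ℂ) →ₗ[ℂ] (V [⋀^Fin k]→ₗ[ℝ] ℂ) :=
  ExteriorAlgebra.liftAlternating (Pi.single k (decomp k))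

theorem toForm_ιMulti (k : ℕ) (θ : Fin k → V →ₗ[ℝ] ℂ) :
    toForm k (ExteriorAlgebra.ιMulti ℂ k θ) = decomp k θ := by
  rw [toForm, ExteriorAlgebra.liftAlternating_apply_ιMulti, Pi.single_eq_same]

def FRep {k : ℕ} (f : V [⋀^Fin k]→ₗ[ℝ] ℂ) (x : ExteriorAlgebra ℂ (V →ₗ[ℝ] ℂ)) : Prop :=
  x ∈ (⋀[ℂ]^k (V →ₗ[ℝ] ℂ)) ∧ f = toForm k x

theorem ιMulti_mul {M : Type*} [AddCommGroup M] [Module ℂ M] {a b : ℕ} (θ : Fin a → M)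
    (φ : Fin b → M) : ExteriorAlgebra.ιMulti ℂ a θ * ExteriorAlgebra.ιMulti ℂ b φ
      = ExteriorAlgebra.ιMulti ℂ (a + b) (Fin.append θ φ) := by
  simp only [ExteriorAlgebra.ιMulti_apply]
  rw [← List.prod_append, ← List.ofFn_fin_append]
  congr 2
  funext i
  refine Fin.addCases (fun i => ?_) (fun i => ?_) i <;> simp

theorem FRep.wedge {a b : ℕ} {f : V [⋀^Fin a]→ₗ[ℝ] ℂ} {g : V [⋀^Fin b]→ₗ[ℝ] ℂ}
    {x y : ExteriorAlgebra ℂ (V →ₗ[ℝ] ℂ)} (hf : FRep f x) (hg : FRep g y) :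
    FRep (wedgeAM f g) (x * y) := by
  obtain ⟨hx, rfl⟩ := hf
  obtain ⟨hy, rfl⟩ := hg
  refine ⟨by rw [ExteriorAlgebra.exteriorPower, pow_add]; exact Submodule.mul_mem_mul hx hy, ?_⟩
  have z1 : ∀ g : V [⋀^Fin b]→ₗ[ℝ] ℂ, wedgeAM (0 : V [⋀^Fin a]→ₗ[ℝ] ℂ) g = 0 := fun g => by
    have := wedge_smul_left 0 (0 : V [⋀^Fin a]→ₗ[ℝ] ℂ) g
    simpa using this
  have z2 : ∀ f : V [⋀^Fin a]→ₗ[ℝ] ℂ, wedgeAM f (0 : V [⋀^Fin b]→ₗ[ℝ] ℂ) = 0 := fun f => by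
    have := wedge_smul_right 0 f (0 : V [⋀^Fin b]→ₗ[ℝ] ℂ)
    simpa using this
  rw [← ExteriorAlgebra.ιMulti_span_fixedDegree] at hx hy
  induction hx using Submodule.span_induction with
  | zero => simp [z1]
  | add x x' _ _ h h' => rw [map_add, wedge_add_left, h, h', add_mul, map_add]
  | smul c x _ h => rw [map_smul, wedge_smul_left, h, smul_mul_assoc, map_smul]
  | mem x hx =>
    obtain ⟨θ, rfl⟩ := hx
    induction hy using Submodule.span_induction with
    | zero => simp [z2]
    | add x x' _ _ h h' => rw [map_add, wedge_add_right, h, h', mul_add, map_add]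
    | smul c x _ h => rw [map_smul, wedge_smul_right, h, mul_smul_comm, map_smul]
    | mem y hy =>
      obtain ⟨φ, rfl⟩ := hy
      rw [toForm_ιMulti, toForm_ιMulti, wedge_decomp, ιMulti_mul, toForm_ιMulti]

theorem FRep.smul {a : ℕ} {f : V [⋀^Fin a]→ₗ[ℝ] ℂ} {x : ExteriorAlgebra ℂ (V →ₗ[ℝ] ℂ)}
    (hf : FRep f x) (c : ℂ) : FRep (c • f) (c • x) :=
  ⟨Submodule.smul_mem _ _ hf.1, by rw [hf.2, map_smul]⟩

theorem FRep.sum {ι : Type*} [Fintype ι] {a : ℕ} {f : ι → V [⋀^Fin a]→ₗ[ℝ] ℂ}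
    {x : ι → ExteriorAlgebra ℂ (V →ₗ[ℝ] ℂ)}
    (hf : ∀ i, FRep (f i) (x i)) : FRep (∑ i, f i) (∑ i, x i) :=
  ⟨Submodule.sum_mem _ fun i _ => (hf i).1, by
    rw [map_sum]; exact Finset.sum_congr rfl fun i _ => (hf i).2⟩

theorem FRep.cast {a b : ℕ} (h : a = b) {f : V [⋀^Fin a]→ₗ[ℝ] ℂ}
    {x : ExteriorAlgebra ℂ (V →ₗ[ℝ] ℂ)} (hf : FRep f x) :
    FRep (f.domDomCongr (finCongr h)) x := by
  subst h
  exact hf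

theorem FRep.ιMulti {k : ℕ} (θ : Fin k → V →ₗ[ℝ] ℂ) :
    FRep (decomp k θ) (ExteriorAlgebra.ιMulti ℂ k θ) :=
  ⟨by rw [← ExteriorAlgebra.ιMulti_span_fixedDegree]; exact Submodule.subset_span ⟨θ, rfl⟩,
    (toForm_ιMulti k θ).symm⟩

variable {n : ℕ} (e : OrthonormalBasis (Fin n) ℂ V)

def zf (i : Fin n) : V →ₗ[ℝ] ℂ := (innerSL ℂ (e i)).toLinearMap.restrictScalars ℝ

def wf (i : Fin n) : V →ₗ[ℝ] ℂ := Complex.conjAe.toLinearMap.comp (zf e i)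

theorem zf_apply (i : Fin n) (v : V) : zf e i v = inner ℂ (e i) v := rfl
theorem wf_apply (i : Fin n) (v : V) : wf e i v = starRingEnd ℂ (inner ℂ (e i) v) := rfl

/-- dual functional -/
def df (j : Fin n) : Module.Dual ℂ (V →ₗ[ℝ] ℂ) where
  toFun θ := (θ (e j) - Complex.I * θ (Complex.I • e j)) / 2
  map_add' := by intro x y; simp; ring
  map_smul' := by intro x y; simp; ring

theorem df_z (j i : Fin n) : df e j (zf e i) = if i = j then 1 else 0 := by
  simp only [df, LinearMap.coe_mk, AddHom.coe_mk, zf_apply, inner_smul_right,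
    orthonormal_iff_ite.mp e.orthonormal]
  rw [← mul_assoc, Complex.I_mul_I]
  split_ifs <;> norm_num

theorem df_w (j i : Fin n) : df e j (wf e i) = 0 := by
  simp only [df, LinearMap.coe_mk, AddHom.coe_mk, wf_apply, inner_smul_right,
    orthonormal_iff_ite.mp e.orthonormal, map_mul, Complex.conj_I]
  rw [← mul_assoc, mul_neg, Complex.I_mul_I]
  split_ifs <;> norm_num

theorem rep_dz (i : Fin n) : FRep (dz1 e i) (ExteriorAlgebra.ι ℂ (zf e i)) := by
  have := FRep.ιMulti (fun _ : Fin 1 => zf e i)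
  convert this using 1
  · ext v
    rw [decomp_apply, alt_prodML_apply]
    simp [dz1, altRestrict, dzC, zf_apply]
  · simp [ExteriorAlgebra.ιMulti_apply]

theorem rep_dzbar (i : Fin n) : FRep (dz1bar e i) (ExteriorAlgebra.ι ℂ (wf e i)) := by
  have := FRep.ιMulti (fun _ : Fin 1 => wf e i)
  convert this using 1
  · ext v
    rw [decomp_apply, alt_prodML_apply]
    simp [dz1bar, conjAM, dz1, altRestrict, dzC, wf_apply]
  · simp [ExteriorAlgebra.ιMulti_apply]

theorem rep_one : FRep (AlternatingMap.constOfIsEmpty ℝ V (Fin 0) (1 : ℂ)) 1 := by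
  have := FRep.ιMulti (fun i : Fin 0 => (Fin.elim0 i : V →ₗ[ℝ] ℂ))
  convert this using 1
  · ext v
    rw [decomp_apply, alt_prodML_apply]
    simp
  · simp [ExteriorAlgebra.ιMulti_apply]

theorem rep_omega : FRep (omegaForm e) (Complex.I • om (zf e) (wf e)) :=
  FRep.smul (FRep.sum fun i => (rep_dz e i).wedge (rep_dzbar e i)) _

theorem rep_omegaPow (k : ℕ) :
    FRep (omegaPow e k) (Complex.I ^ k • om (zf e) (wf e) ^ k) := by
  induction k with
  | zero => simp only [pow_zero, one_smul]; exact rep_one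
  | succ k ih =>
    have := (ih.wedge (rep_omega e)).cast (show 2 * k + 2 = 2 * (k + 1) by omega)
    rw [smul_mul_smul_comm, ← pow_succ, ← pow_succ] at this
    exact this

theorem eta_expand {p : ℕ} (η : V [⋀^Fin p]→ₗ[ℂ] ℂ) (v : Fin p → V) :
    η v = ∑ I : Fin p → Fin n, η (fun l => e (I l)) * ∏ l, inner ℂ (e (I l)) (v l) := by
  conv_lhs => rw [show v = fun l => ∑ i, (inner ℂ (e i) (v l) : ℂ) • e i from
    funext fun l => (e.sum_repr' (v l)).symm]
  rw [← AlternatingMap.coe_multilinearMap, MultilinearMap.map_sum]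
  refine Finset.sum_congr rfl fun I _ => ?_
  rw [MultilinearMap.map_smul_univ, smul_eq_mul, mul_comm]


theorem eta_alt {p : ℕ} (η : V [⋀^Fin p]→ₗ[ℂ] ℂ) (v : Fin p → V) :
    ∑ I : Fin p → Fin n, η (fun l => e (I l)) * (∑ σ : Equiv.Perm (Fin p),
      ((Equiv.Perm.sign σ : ℤ) : ℂ) * ∏ l, inner ℂ (e (I l)) (v (σ l)))
      = (p.factorial : ℂ) * η v := by
  simp only [Finset.mul_sum]
  rw [Finset.sum_comm]
  have : ∀ σ : Equiv.Perm (Fin p), ∑ I : Fin p → Fin n, η (fun l => e (I l)) *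
      (((Equiv.Perm.sign σ : ℤ) : ℂ) * ∏ l, inner ℂ (e (I l)) (v (σ l))) = η v := by
    intro σ
    have h := eta_expand e η (fun l => v (σ l))
    have h' : η (fun l => v (σ l)) = ((Equiv.Perm.sign σ : ℤ) : ℂ) * η v := by
      have := η.map_perm v σ
      simpa [Units.smul_def, Function.comp_def] using this
    rw [h'] at h
    have hs : ((Equiv.Perm.sign σ : ℤ) : ℂ) * ((Equiv.Perm.sign σ : ℤ) : ℂ) = 1 := by
      rw [← Int.cast_mul, ← Units.val_mul, Int.units_mul_self]; simp
    calc _ = ((Equiv.Perm.sign σ : ℤ) : ℂ) * ∑ I : Fin p → Fin n, η (fun l => e (I l)) *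
          ∏ l, inner ℂ (e (I l)) (v (σ l)) := by
            rw [Finset.mul_sum]; exact Finset.sum_congr rfl fun _ _ => by ring
      _ = _ := by rw [← h, ← mul_assoc, hs, one_mul]
  simp [this, Fintype.card_perm]

theorem alt_sum_apply {ι : Type*} [Fintype ι] {k : ℕ} (f : ι → V [⋀^Fin k]→ₗ[ℝ] ℂ)
    (v : Fin k → V) : (∑ i, f i) v = ∑ i, f i v :=
  map_sum ({ toFun := fun g => g v, map_zero' := rfl, map_add' := fun _ _ => rfl } :
    (V [⋀^Fin k]→ₗ[ℝ] ℂ) →+ ℂ) f Finset.univ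

theorem rep_eta {p : ℕ} (η : V [⋀^Fin p]→ₗ[ℂ] ℂ) :
    FRep (altRestrict η) ((p.factorial : ℂ)⁻¹ • ∑ I : Fin p → Fin n,
      η (fun l => e (I l)) • zProd (zf e) I) := by
  have := FRep.smul (FRep.sum fun I : Fin p → Fin n =>
    (FRep.ιMulti (fun l => zf e (I l))).smul (η (fun l => e (I l)))) (p.factorial : ℂ)⁻¹
  refine ⟨this.1, Eq.trans ?_ this.2⟩
  ext v
  have h := eta_alt e η v
  simp only [AlternatingMap.smul_apply, alt_sum_apply, decomp_apply, alt_prodML_apply,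
    zf_apply, smul_eq_mul]
  rw [h, ← mul_assoc, inv_mul_cancel₀ (by exact_mod_cast p.factorial_ne_zero), one_mul]
  rfl

theorem rep_etabar {p : ℕ} (η : V [⋀^Fin p]→ₗ[ℂ] ℂ) :
    FRep (conjAM (altRestrict η)) ((p.factorial : ℂ)⁻¹ • ∑ I : Fin p → Fin n,
      starRingEnd ℂ (η (fun l => e (I l))) • zProd (wf e) I) := by
  have := FRep.smul (FRep.sum fun I : Fin p → Fin n =>
    (FRep.ιMulti (fun l => wf e (I l))).smul (starRingEnd ℂ (η (fun l => e (I l)))))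
      (p.factorial : ℂ)⁻¹
  refine ⟨this.1, Eq.trans ?_ this.2⟩
  ext v
  have h := congrArg (starRingEnd ℂ) (eta_alt e η v)
  simp only [map_sum, map_mul, map_prod, Complex.conj_natCast, map_intCast] at h
  simp only [AlternatingMap.smul_apply, alt_sum_apply, decomp_apply, alt_prodML_apply,
    wf_apply, smul_eq_mul]
  rw [h, ← mul_assoc, inv_mul_cancel₀ (by exact_mod_cast p.factorial_ne_zero), one_mul]
  rfl
end forms
section fin
variable {V : Type*} [NormedAddCommGroup V] [InnerProductSpace ℂ V]
variable {n : ℕ} (e : OrthonormalBasis (Fin n) ℂ V)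

theorem eta_dl {p : ℕ} (η : V [⋀^Fin p]→ₗ[ℂ] ℂ) (K : Fin p → Fin n) :
    ∑ I : Fin p → Fin n, η (fun l => e (I l)) * (dl I K).det
      = (p.factorial : ℂ) * η (fun l => e (K l)) := by
  rw [← eta_alt e]
  refine Finset.sum_congr rfl fun I _ => ?_
  rw [← Matrix.det_transpose, Matrix.det_apply']
  simp [dl, orthonormal_iff_ite.mp e.orthonormal]

theorem det_dl_cons {p : ℕ} (i j : Fin n) (I K : Fin (p + 1) → Fin n) :
    (dl (Fin.cons i I : Fin (p + 2) → Fin n) (Fin.cons j K)).det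
      = (if i = j then 1 else 0) * (dl I K).det
        + ∑ k : Fin (p + 1), (-1 : ℂ) ^ ((k : ℕ) + 1) * (if i = K k then 1 else 0) *
          (dl I (Fin.cons j (fun l => K (k.succAbove l)))).det := by
  rw [Matrix.det_succ_row_zero, Fin.sum_univ_succ]
  congr 1
  · have : (dl (Fin.cons i I : Fin (p + 2) → Fin n) (Fin.cons j K)).submatrix Fin.succ
        (Fin.succAbove 0) = dl I K := by ext; simp [dl]
    rw [this]; simp [dl]
  · refine Finset.sum_congr rfl fun k _ => ?_
    have : (dl (Fin.cons i I : Fin (p + 2) → Fin n) (Fin.cons j K)).submatrix Fin.succ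
        (Fin.succAbove k.succ) = dl I (Fin.cons j (fun l => K (k.succAbove l))) := by
      ext a b
      refine Fin.cases ?_ (fun b => ?_) b <;> simp [dl]
    rw [this]; simp [dl]

theorem eta_insertNth {m : ℕ} (η : V [⋀^Fin (m + 1)]→ₗ[ℂ] ℂ) (k : Fin (m + 1)) (x : V)
    (v : Fin m → V) :
    η (k.insertNth x v : Fin (m + 1) → V) = (-1) ^ (k : ℕ) * η (Fin.cons x v : Fin (m + 1) → V) := by
  have h := η.map_perm (k.insertNth x v : Fin (m + 1) → V) k.cycleRange.symm
  have h2 : (k.insertNth x v : Fin (m + 1) → V) ∘ k.cycleRange.symm = Fin.cons x v := by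
    funext l
    refine Fin.cases ?_ (fun l => ?_) l <;> simp
  rw [h2] at h
  rw [h]
  simp [Fin.sign_cycleRange, Units.smul_def, ← mul_assoc, ← mul_pow]

theorem scalar_T {m : ℕ} (η : V [⋀^Fin (m + 1)]→ₗ[ℂ] ℂ) (i j : Fin n) :
    ∑ I : Fin (m + 1) → Fin n, ∑ K : Fin (m + 1) → Fin n,
      η (fun l => e (I l)) * starRingEnd ℂ (η fun l => e (K l)) *
        (dl (Fin.cons i I : Fin (m + 2) → Fin n) (Fin.cons j K)).det
    = ((m + 1).factorial : ℂ) * ((if i = j then 1 else 0) * ∑ K : Fin (m + 1) → Fin n,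
        η (fun l => e (K l)) * starRingEnd ℂ (η fun l => e (K l))
      - ((m : ℂ) + 1) * ∑ J : Fin m → Fin n, η (Fin.cons (e j) fun l => e (J l)) *
          starRingEnd ℂ (η (Fin.cons (e i) fun l => e (J l)))) := by
  have hk : ∀ k : Fin (m + 1), ∑ K : Fin (m + 1) → Fin n, starRingEnd ℂ (η fun l => e (K l)) *
      ((-1 : ℂ) ^ ((k : ℕ) + 1) * (if i = K k then 1 else 0) *
        η (Fin.cons (e j) (fun l => e (K (k.succAbove l)))))
      = - ∑ J : Fin m → Fin n, η (Fin.cons (e j) fun l => e (J l)) *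
          starRingEnd ℂ (η (Fin.cons (e i) fun l => e (J l))) := by
    intro k
    rw [← (Fin.insertNthEquiv (fun _ => Fin n) k).sum_comp, Fintype.sum_prod_type,
      Finset.sum_eq_single i, ← Finset.sum_neg_distrib]
    · refine Finset.sum_congr rfl fun J _ => ?_
      have h1 : (fun l => e ((Fin.insertNthEquiv (fun _ => Fin n) k) (i, J) l))
          = (k.insertNth (e i) (fun l => e (J l)) : Fin (m + 1) → V) := by
        funext l
        refine Fin.succAboveCases k ?_ (fun l => ?_) l <;> simp
      rw [h1, eta_insertNth]
      simp only [Fin.insertNthEquiv_apply, Fin.insertNth_apply_same,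
        Fin.insertNth_apply_succAbove, if_true, map_mul, map_pow, map_neg, map_one]
      have h : ((-1 : ℂ) ^ (k : ℕ)) * (-1) ^ (k : ℕ) = 1 := by rw [← mul_pow]; simp
      rw [pow_succ]
      linear_combination (-(starRingEnd ℂ (η (Fin.cons (e i) fun l => e (J l)))) *
        η (Fin.cons (e j) fun l => e (J l))) * h
    · intro x _ hx
      refine Finset.sum_eq_zero fun J _ => ?_
      simp [hx.symm]
    · simp
  have h1 : ∀ K : Fin (m + 1) → Fin n, ∑ I : Fin (m + 1) → Fin n,
      η (fun l => e (I l)) * starRingEnd ℂ (η fun l => e (K l)) *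
        (dl (Fin.cons i I : Fin (m + 2) → Fin n) (Fin.cons j K)).det
      = ((m + 1).factorial : ℂ) * ((if i = j then 1 else 0) *
        (η (fun l => e (K l)) * starRingEnd ℂ (η fun l => e (K l))) +
        ∑ k : Fin (m + 1), starRingEnd ℂ (η fun l => e (K l)) *
      ((-1 : ℂ) ^ ((k : ℕ) + 1) * (if i = K k then 1 else 0) *
        η (Fin.cons (e j) (fun l => e (K (k.succAbove l)))))) := by
    intro K
    have h2 : ∀ k : Fin (m + 1), η (Fin.cons (e j) (fun l => e (K (k.succAbove l))))
        = η (fun l => e ((Fin.cons j (fun l => K (k.succAbove l)) : Fin (m + 1) → Fin n) l)) := by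
      intro k
      congr 1
      funext l
      refine Fin.cases ?_ (fun l => ?_) l <;> simp
    simp only [det_dl_cons, mul_add, Finset.mul_sum, Finset.sum_add_distrib]
    congr 1
    · have := eta_dl e η K
      calc _ = (if i = j then 1 else 0) * starRingEnd ℂ (η fun l => e (K l)) *
            ∑ I : Fin (m + 1) → Fin n, η (fun l => e (I l)) * (dl I K).det := by
              rw [Finset.mul_sum]; exact Finset.sum_congr rfl fun _ _ => by ring
        _ = _ := by rw [this]; ring
    · rw [Finset.sum_comm]
      refine Finset.sum_congr rfl fun k _ => ?_
      have := eta_dl e η (Fin.cons j (fun l => K (k.succAbove l)))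
      rw [h2]
      calc _ = (-1 : ℂ) ^ ((k : ℕ) + 1) * (if i = K k then 1 else 0) *
            starRingEnd ℂ (η fun l => e (K l)) *
            ∑ I : Fin (m + 1) → Fin n, η (fun l => e (I l)) *
              (dl I (Fin.cons j (fun l => K (k.succAbove l)))).det := by
              rw [Finset.mul_sum]; exact Finset.sum_congr rfl fun _ _ => by ring
        _ = _ := by rw [this]; ring
  rw [Finset.sum_comm]
  simp only [h1]
  rw [← Finset.mul_sum, Finset.sum_add_distrib, ← Finset.mul_sum, Finset.sum_comm]
  simp only [hk]
  simp
  ring_nf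
  simp

theorem term_alg {m q : ℕ} (hq : m + 1 + 1 + q = n) (i j : Fin n) (I K : Fin (m + 1) → Fin n) :
    ExteriorAlgebra.ι ℂ (zf e i) * ExteriorAlgebra.ι ℂ (wf e j) * zProd (zf e) I *
      zProd (wf e) K * om (zf e) (wf e) ^ q
    = ((n.factorial : ℂ)⁻¹ * (sg (m + 1) * q.factorial *
        (dl (Fin.cons i I : Fin (m + 2) → Fin n) (Fin.cons j K)).det)) •
        om (zf e) (wf e) ^ n := by
  have h := main_alg (zf e) (wf e) (df e) (df_z e) (df_w e) (m + 2) q hq (Fin.cons i I)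
    (Fin.cons j K)
  have hn : (n.factorial : ℂ) ≠ 0 := by exact_mod_cast n.factorial_ne_zero
  rw [zProd_cons, zProd_cons] at h
  rw [mul_smul, eq_inv_smul_iff₀ hn, mul_assoc (ExteriorAlgebra.ι ℂ (zf e i)), ι_zProd_comm]
  have h' : ((-1 : ℂ) ^ (m + 1)) * (-1) ^ (m + 1) = 1 := by rw [← mul_pow]; simp
  have h3 : sg (m + 2) = (-1) ^ (m + 1) * sg (m + 1) := rfl
  rw [h3] at h
  have h4 := congrArg (fun y => ((-1 : ℂ) ^ (m + 1)) • y) h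
  simp only [smul_smul] at h4
  simp only [mul_smul_comm, smul_mul_assoc, smul_smul, mul_assoc] at h4 ⊢
  rw [mul_comm _ ((-1 : ℂ) ^ (m + 1)), h4]
  congr 1
  linear_combination (sg (m + 1) * (q.factorial *
    (dl (Fin.cons i I : Fin (m + 2) → Fin n) (Fin.cons j K)).det)) * h'

theorem sum4 {α β M : Type*} [Fintype α] [Fintype β] [AddCommMonoid M]
    (f : α → α → β → β → M) :
    ∑ a, ∑ b, ∑ c, ∑ d, f a b c d = ∑ c, ∑ d, ∑ b, ∑ a, f a b c d := by
  calc _ = ∑ b, ∑ a, ∑ c, ∑ d, f a b c d := Finset.sum_comm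
    _ = ∑ b, ∑ c, ∑ a, ∑ d, f a b c d := Finset.sum_congr rfl fun _ _ => Finset.sum_comm
    _ = ∑ c, ∑ b, ∑ a, ∑ d, f a b c d := Finset.sum_comm
    _ = ∑ c, ∑ b, ∑ d, ∑ a, f a b c d :=
      Finset.sum_congr rfl fun _ _ => Finset.sum_congr rfl fun _ _ => Finset.sum_comm
    _ = _ := Finset.sum_congr rfl fun _ _ => Finset.sum_comm

end fin


/-- **Zhang–Zhang, Lemma 3.2; pointwise form.** Let `V` be an `n`-dimensional
complex inner product space with Kähler form `ω`, `α = √-1 ∑ A_{ij̄} dz^i∧dz̄^j` a real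
`(1,1)`-form (`A` Hermitian), and `η` a `(p,0)`-form (`p = m+1`, `p + 1 ≤ n`) with associated
semipositive `(1,1)`-form `β = √-1 ∑ b_{ij̄} dz^i∧dz̄^j`,
`b_{ij̄} = (1/p!)·∑_{J} η_{iJ}·conj(η_{jJ})` (equivalently `β = Λ^{p-1}((√-1)^{p²}η∧η̄/p!)`).
Then `(√-1)^{p²}·α∧η∧η̄∧ω^{n-p-1}/(n-p-1)! = [tr_ω α·|η|² − p·⟨α,β⟩]·ω^n/n!` as top-degree
forms on `V`, where `tr_ω α = ∑ᵢ A_{iī}`, `|η|²` is the pointwise norm of `η` and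
`⟨α,β⟩ = ∑_{i,j} A_{ij̄}·conj(b_{ij̄})`. -/
theorem stmt_6 {V : Type*} [NormedAddCommGroup V] [InnerProductSpace ℂ V]
    [FiniteDimensional ℂ V]
    (n m : ℕ) (hp : m + 1 + 1 ≤ n) (hrank : Module.finrank ℂ V = n)
    (e : OrthonormalBasis (Fin n) ℂ V)
    (A : Matrix (Fin n) (Fin n) ℂ) (hA : A.IsHermitian)
    (η : V [⋀^Fin (m + 1)]→ₗ[ℂ] ℂ) :
    ((((n - (m + 1) - 1 : ℕ)).factorial : ℝ)⁻¹ •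
        (Complex.I ^ ((m + 1) ^ 2) •
          wedgeAM
            (wedgeAM
              (wedgeAM (Complex.I • ∑ i, ∑ j, A i j • wedgeAM (dz1 e i) (dz1bar e j))
                (altRestrict η))
              (conjAM (altRestrict η)))
            (omegaPow e (n - (m + 1) - 1)))).domDomCongr (finCongr (by omega))
      = (((∑ i, A i i) *
            (((1 : ℝ) / (m + 1).factorial) *
                ∑ I : Fin (m + 1) → Fin n, ‖η fun l => e (I l)‖ ^ 2 : ℝ) -
            ((m : ℂ) + 1) *
              ∑ i, ∑ j,
                A i j *
                  starRingEnd ℂ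
                    (((1 : ℂ) / (m + 1).factorial) *
                      ∑ J : Fin m → Fin n,
                        η (Fin.cons (e i) fun l => e (J l)) *
                          starRingEnd ℂ (η (Fin.cons (e j) fun l => e (J l))))) •
          ((n.factorial : ℂ)⁻¹ • (omegaPow e n).domDomCongr (finCongr rfl))) := by
  have hqn : m + 1 + 1 + (n - (m + 1) - 1) = n := by omega
  generalize_proofs hcast
  revert hcast
  revert hqn
  generalize n - (m + 1) - 1 = q
  intro hqn hcast
  have hα : FRep (Complex.I • ∑ i, ∑ j, A i j • wedgeAM (dz1 e i) (dz1bar e j))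
      (Complex.I • ∑ i, ∑ j, A i j •
        (ExteriorAlgebra.ι ℂ (zf e i) * ExteriorAlgebra.ι ℂ (wf e j))) :=
    FRep.smul (FRep.sum fun i => FRep.sum fun j =>
      ((rep_dz e i).wedge (rep_dzbar e j)).smul _) _
  have hL := ((((hα.wedge (rep_eta e η)).wedge (rep_etabar e η)).wedge (rep_omegaPow e q)).smul
    (Complex.I ^ ((m + 1) ^ 2))).smul ((q.factorial : ℂ)⁻¹)
  have hL' := hL.cast (show 1 + 1 + (m + 1) + (m + 1) + 2 * q = 2 * n by omega)
  have hR := (((rep_omegaPow e n).cast (rfl : 2 * n = 2 * n)).smul ((n.factorial : ℂ)⁻¹)).smul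
    (((∑ i, A i i) *
            (((1 : ℝ) / (m + 1).factorial) *
                ∑ I : Fin (m + 1) → Fin n, ‖η fun l => e (I l)‖ ^ 2 : ℝ) -
            ((m : ℂ) + 1) *
              ∑ i, ∑ j,
                A i j *
                  starRingEnd ℂ
                    (((1 : ℂ) / (m + 1).factorial) *
                      ∑ J : Fin m → Fin n,
                        η (Fin.cons (e i) fun l => e (J l)) *
                          starRingEnd ℂ (η (Fin.cons (e j) fun l => e (J l))))))
  have hreal : ∀ f : V [⋀^Fin (1 + 1 + (m + 1) + (m + 1) + 2 * q)]→ₗ[ℝ] ℂ,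
      ((q.factorial : ℝ)⁻¹) • f = ((q.factorial : ℂ)⁻¹) • f := by
    intro f
    ext v
    simp [AlternatingMap.smul_apply]
  rw [hreal]
  refine hL'.2.trans (Eq.trans ?_ hR.2.symm)
  congr 1
  have hexp : (Complex.I • ∑ i, ∑ j, A i j •
        (ExteriorAlgebra.ι ℂ (zf e i) * ExteriorAlgebra.ι ℂ (wf e j))) *
      (((m + 1).factorial : ℂ)⁻¹ • ∑ I : Fin (m + 1) → Fin n,
        η (fun l => e (I l)) • zProd (zf e) I) *
      (((m + 1).factorial : ℂ)⁻¹ • ∑ I : Fin (m + 1) → Fin n,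
        starRingEnd ℂ (η (fun l => e (I l))) • zProd (wf e) I) *
      (Complex.I ^ q • om (zf e) (wf e) ^ q)
      = (Complex.I * Complex.I ^ q * ((m + 1).factorial : ℂ)⁻¹ * ((m + 1).factorial : ℂ)⁻¹ *
          ((n.factorial : ℂ)⁻¹ * sg (m + 1) * q.factorial) *
          ∑ i, ∑ j, A i j * ∑ I : Fin (m + 1) → Fin n, ∑ K : Fin (m + 1) → Fin n,
      η (fun l => e (I l)) * starRingEnd ℂ (η fun l => e (K l)) *
        (dl (Fin.cons i I : Fin (m + 2) → Fin n) (Fin.cons j K)).det) •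
          om (zf e) (wf e) ^ n := by
    simp only [Finset.mul_sum, Finset.sum_smul, Finset.sum_mul, smul_mul_assoc, mul_smul_comm,
      Finset.smul_sum, smul_smul]
    simp only [term_alg e hqn, smul_smul]
    rw [sum4]
    refine Finset.sum_congr rfl fun i _ => Finset.sum_congr rfl fun j _ =>
      Finset.sum_congr rfl fun I _ => Finset.sum_congr rfl fun K _ => ?_
    congr 1
    ring
  rw [hexp]
  simp only [scalar_T, smul_smul]
  congr 1
  have hq0 : (q.factorial : ℂ) ≠ 0 := by exact_mod_cast q.factorial_ne_zero
  have hm0 : ((m + 1).factorial : ℂ) ≠ 0 := by exact_mod_cast (m + 1).factorial_ne_zero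
  have hn0 : (n.factorial : ℂ) ≠ 0 := by exact_mod_cast n.factorial_ne_zero
  have hI : Complex.I ^ n = Complex.I * Complex.I ^ q * (sg (m + 1) * Complex.I ^ ((m + 1) ^ 2)) := by
    rw [sg_I, ← hqn]; ring
  have hN : ((((1 : ℝ) / (m + 1).factorial) *
      ∑ I : Fin (m + 1) → Fin n, ‖η fun l => e (I l)‖ ^ 2 : ℝ) : ℂ)
      = ((m + 1).factorial : ℂ)⁻¹ * ∑ K : Fin (m + 1) → Fin n,
        η (fun l => e (K l)) * starRingEnd ℂ (η fun l => e (K l)) := by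
    push_cast
    simp only [Complex.mul_conj']
    rw [one_div]
  have hS : ∑ i, ∑ j, A i j * (((m + 1).factorial : ℂ) * ((if i = j then 1 else 0) *
        ∑ K : Fin (m + 1) → Fin n, η (fun l => e (K l)) * starRingEnd ℂ (η fun l => e (K l))
      - ((m : ℂ) + 1) * ∑ J : Fin m → Fin n, η (Fin.cons (e j) fun l => e (J l)) *
          starRingEnd ℂ (η (Fin.cons (e i) fun l => e (J l)))))
      = ((m + 1).factorial : ℂ) * ((∑ i, A i i) * (∑ K : Fin (m + 1) → Fin n,
          η (fun l => e (K l)) * starRingEnd ℂ (η fun l => e (K l)))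
        - ((m : ℂ) + 1) * ∑ i, ∑ j, A i j * ∑ J : Fin m → Fin n,
          η (Fin.cons (e j) fun l => e (J l)) *
          starRingEnd ℂ (η (Fin.cons (e i) fun l => e (J l)))) := by
    generalize (∑ K : Fin (m + 1) → Fin n,
          η (fun l => e (K l)) * starRingEnd ℂ (η fun l => e (K l))) = N
    rw [mul_sub, Finset.sum_mul, Finset.mul_sum, Finset.mul_sum, Finset.mul_sum,
      ← Finset.sum_sub_distrib]
    refine Finset.sum_congr rfl fun i _ => ?_
    have h1 : A i i = ∑ j, A i j * (if i = j then 1 else 0) := by simp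
    rw [h1, Finset.sum_mul, Finset.mul_sum, Finset.mul_sum, Finset.mul_sum,
      ← Finset.sum_sub_distrib]
    exact Finset.sum_congr rfl fun j _ => by ring
  have hB : ∑ i, ∑ j, A i j * starRingEnd ℂ (((1 : ℂ) / (m + 1).factorial) *
      ∑ J : Fin m → Fin n, η (Fin.cons (e i) fun l => e (J l)) *
        starRingEnd ℂ (η (Fin.cons (e j) fun l => e (J l))))
      = ((m + 1).factorial : ℂ)⁻¹ * ∑ i, ∑ j, A i j * ∑ J : Fin m → Fin n,
          η (Fin.cons (e j) fun l => e (J l)) *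
          starRingEnd ℂ (η (Fin.cons (e i) fun l => e (J l))) := by
    rw [Finset.mul_sum]
    refine Finset.sum_congr rfl fun i _ => ?_
    rw [Finset.mul_sum]
    refine Finset.sum_congr rfl fun j _ => ?_
    rw [map_mul, map_sum, map_div₀, map_one, Complex.conj_natCast, one_div]
    have h1 : ∀ J : Fin m → Fin n, starRingEnd ℂ (η (Fin.cons (e i) fun l => e (J l)) *
        starRingEnd ℂ (η (Fin.cons (e j) fun l => e (J l))))
        = η (Fin.cons (e j) fun l => e (J l)) *
          starRingEnd ℂ (η (Fin.cons (e i) fun l => e (J l))) := by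
      intro J
      rw [map_mul, Complex.conj_conj, mul_comm]
    simp only [h1]
    ring
  rw [hS, hN, hB, hI]
  field_simp
end
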